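/- The largest minimum weight among all binary LCD [24,12] codes equals 6; that is, there exists a 12-dimensional linear complementary dual subspace of F_2^24 with minimum weight 6, and no such subspace has minimum weight 7 or larger. -/

import Mathlib

/-- The (Hamming) weight of a vector over `F_2`. -/
def wt {n : ℕ} (x : Fin n → ZMod 2) : ℕ :=
  Finset.card (Finset.univ.filter fun i => x i ≠ 0)

/-- The dual code of a binary code `C`, with respect to the standard inner product. -/
def dualCode {n : ℕ} (C : Submodule (ZMod 2) (Fin n → ZMod 2)) :
    Submodule (ZMod 2) (Fin n → ZMod 2) where
  carrier := {x | ∀ y ∈ C, ∑ i, x i * y i = 0}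
  add_mem' := by
    intro a b ha hb y hy
    simp [Pi.add_apply, add_mul, Finset.sum_add_distrib, ha y hy, hb y hy]
  zero_mem' := by
    intro y hy
    simp
  smul_mem' := by
    intro c a ha y hy
    simp only [Pi.smul_apply, smul_eq_mul, mul_assoc, ← Finset.mul_sum, ha y hy, mul_zero]

/-- A binary code is linear complementary dual (LCD) if it meets its dual trivially. -/
def IsLCD {n : ℕ} (C : Submodule (ZMod 2) (Fin n → ZMod 2)) : Prop :=
  C ⊓ dualCode C = ⊥

/-- The minimum weight of a binary code: the smallest weight of a nonzero codeword. -/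
noncomputable def minWt {n : ℕ} (C : Submodule (ZMod 2) (Fin n → ZMod 2)) : ℕ :=
  sInf {w | ∃ x ∈ C, x ≠ 0 ∧ wt x = w}

/-- `dLCD n k` is the largest minimum weight among all binary LCD `[n,k]` codes. -/
noncomputable def dLCD (n k : ℕ) : ℕ :=
  sSup {d | ∃ C : Submodule (ZMod 2) (Fin n → ZMod 2),
    Module.finrank (ZMod 2) C = k ∧ IsLCD C ∧ minWt C = d}

section SignedSums

/-- The nontrivial character of `F_2`. -/
def sgn (a : ZMod 2) : ℤ := if a = 0 then 1 else -1

lemma sgn_zero : sgn 0 = 1 := rfl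

lemma sgn_add (a b : ZMod 2) : sgn (a + b) = sgn a * sgn b := by
  revert a b; decide

lemma sgn_sum {ι : Type*} (s : Finset ι) (f : ι → ZMod 2) :
    sgn (∑ i ∈ s, f i) = ∏ i ∈ s, sgn (f i) := by
  classical
  induction s using Finset.induction_on with
  | empty => simp [sgn_zero]
  | insert a s ha ih => rw [Finset.sum_insert ha, Finset.prod_insert ha, sgn_add, ih]

/-- Orthogonality relation for the characters of a finite elementary abelian `2`-group. -/
lemma sum_sgn {V : Type*} [AddCommGroup V] [Fintype V] (φ : V →+ ZMod 2) [Decidable (φ = 0)] :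
    ∑ x, sgn (φ x) = if φ = 0 then (Fintype.card V : ℤ) else 0 := by
  split_ifs with h
  · simp [h, sgn_zero]
  · obtain ⟨v, hv⟩ : ∃ v, φ v ≠ 0 := by
      by_contra! hcon
      exact h (AddMonoidHom.ext hcon)
    have hs : ∑ x, sgn (φ x) = ∑ x, sgn (φ (x + v)) :=
      (Equiv.sum_comp (Equiv.addRight v) fun x => sgn (φ x)).symm
    have hneg : ∑ x, sgn (φ (x + v)) = -∑ x, sgn (φ x) := by
      rw [← Finset.sum_neg_distrib]
      refine Finset.sum_congr rfl fun x _ => ?_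
      rw [map_add, sgn_add, show sgn (φ v) = -1 from if_neg hv]
      ring
    omega

lemma sum_sgn_nonneg {V : Type*} [AddCommGroup V] [Fintype V] (φ : V →+ ZMod 2) :
    0 ≤ ∑ x, sgn (φ x) := by
  classical
  rw [sum_sgn]
  split_ifs <;> positivity

end SignedSums

section Weights

variable {n : ℕ}

lemma wt_eq_sum (x : Fin n → ZMod 2) : wt x = ∑ i, (x i).val := by
  rw [wt, Finset.card_filter]
  refine Finset.sum_congr rfl fun i _ => ?_
  generalize x i = a
  revert a; decide

lemma natCast_wt (x : Fin n → ZMod 2) : (wt x : ZMod 2) = ∑ i, x i := by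
  rw [wt_eq_sum]; simp

lemma sum_sgn_apply (x : Fin n → ZMod 2) : ∑ i, sgn (x i) = n - 2 * wt x := by
  have h : ∀ a : ZMod 2, sgn a = 1 - 2 * a.val := by decide
  simp [h, wt_eq_sum, Finset.mul_sum]

lemma wt_add (x y : Fin n → ZMod 2) : wt (x + y) + 2 * wt (x * y) = wt x + wt y := by
  simp only [wt_eq_sum, Finset.mul_sum, ← Finset.sum_add_distrib]
  refine Finset.sum_congr rfl fun i _ => ?_
  simp only [Pi.add_apply, Pi.mul_apply]
  generalize x i = a
  generalize y i = b
  revert a b; decide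

lemma sgn_natCast (m : ℕ) : sgn (m : ZMod 2) = (-1) ^ m := by
  induction m with
  | zero => rfl
  | succ m ih => rw [Nat.cast_succ, sgn_add, ih, pow_succ]; rfl

end Weights

section QuadraticSum

variable {n : ℕ}

/-- The sign `(-1) ^ (wt x / 2)`, meant for vectors of even weight. -/
def halfSign (x : Fin n → ZMod 2) : ℤ := (-1) ^ (wt x / 2)

lemma halfSign_mul_halfSign_add {x z : Fin n → ZMod 2} (hx : Even (wt x)) (hz : Even (wt z)) :
    halfSign x * halfSign (x + z) = halfSign z * sgn (∑ i, z i * x i) := by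
  obtain ⟨a, ha⟩ := hx
  obtain ⟨b, hb⟩ := hz
  have h := wt_add x z
  have hxz : ∑ i, z i * x i = (wt (x * z) : ZMod 2) := by
    rw [natCast_wt]
    exact Finset.sum_congr rfl fun i _ => mul_comm _ _
  rw [hxz, sgn_natCast]
  unfold halfSign
  rw [← pow_add, ← pow_add]
  exact neg_one_pow_congr (by grind)

open Classical in
lemma sq_sum_halfSign_le {D : Submodule (ZMod 2) (Fin n → ZMod 2)}
    (heven : ∀ x ∈ D, Even (wt x)) :
    (∑ x : D, halfSign (x : Fin n → ZMod 2)) ^ 2 ≤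
      Fintype.card D * Fintype.card ↥(D ⊓ dualCode D) := by
  let φ (z : D) : D →+ ZMod 2 :=
    { toFun := fun x => ∑ i, (z : Fin n → ZMod 2) i * (x : Fin n → ZMod 2) i
      map_zero' := by simp
      map_add' := fun x y => by simp [mul_add, Finset.sum_add_distrib] }
  have hφ (z : D) : φ z = 0 ↔ (z : Fin n → ZMod 2) ∈ dualCode D :=
    ⟨fun h y hy => DFunLike.congr_fun h ⟨y, hy⟩, fun h => AddMonoidHom.ext fun y => h y y.2⟩
  have hcard : Fintype.card {z : D // φ z = 0} = Fintype.card ↥(D ⊓ dualCode D) :=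
    Fintype.card_congr
      { toFun := fun z => ⟨z.1, z.1.2, (hφ z.1).1 z.2⟩
        invFun := fun z => ⟨⟨z.1, z.2.1⟩, (hφ ⟨z.1, z.2.1⟩).2 z.2.2⟩
        left_inv := fun _ => rfl
        right_inv := fun _ => rfl }
  have hle (z : D) : halfSign (z : Fin n → ZMod 2) ≤ 1 := by
    rcases neg_one_pow_eq_or ℤ (wt (z : Fin n → ZMod 2) / 2) with h | h <;>
      simp [halfSign, h]
  calc (∑ x : D, halfSign (x : Fin n → ZMod 2)) ^ 2
      = ∑ x : D, ∑ z : D, halfSign (x : Fin n → ZMod 2) *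
          halfSign ((x + z : D) : Fin n → ZMod 2) := by
        rw [sq, Finset.sum_mul_sum]
        refine Finset.sum_congr rfl fun x _ => ?_
        exact (Equiv.sum_comp (Equiv.addLeft x)
          fun y : D => halfSign (x : Fin n → ZMod 2) * halfSign (y : Fin n → ZMod 2)).symm
    _ = ∑ z : D, halfSign (z : Fin n → ZMod 2) * ∑ x : D, sgn (φ z x) := by
        rw [Finset.sum_comm]
        refine Finset.sum_congr rfl fun z _ => ?_
        rw [Finset.mul_sum]
        exact Finset.sum_congr rfl fun x _ =>
          halfSign_mul_halfSign_add (heven x x.2) (heven z z.2)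
    _ ≤ ∑ z : D, ∑ x : D, sgn (φ z x) :=
        Finset.sum_le_sum fun z _ => mul_le_of_le_one_left (sum_sgn_nonneg _) (hle z)
    _ = Fintype.card D * Fintype.card ↥(D ⊓ dualCode D) := by
        simp only [sum_sgn]
        rw [← Finset.sum_filter, Finset.sum_const, ← Fintype.card_subtype, hcard, nsmul_eq_mul,
          mul_comm]

end QuadraticSum

section LinearProgramming

variable {n : ℕ}

/-- The `k`-th elementary symmetric function of the signs of the coordinates of `x`, i.e. the
value at `wt x` of the `k`-th Krawtchouk polynomial. -/
def signEsymm (k : ℕ) (x : Fin n → ZMod 2) : ℤ :=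
  ∑ s ∈ Finset.powersetCard k Finset.univ, ∏ i ∈ s, sgn (x i)

lemma sum_signEsymm_nonneg (D : Submodule (ZMod 2) (Fin n → ZMod 2)) [Fintype D] (k : ℕ) :
    0 ≤ ∑ x : D, signEsymm k (x : Fin n → ZMod 2) := by
  simp only [signEsymm]
  rw [Finset.sum_comm]
  refine Finset.sum_nonneg fun s _ => ?_
  let φ : D →+ ZMod 2 :=
    { toFun := fun x => ∑ i ∈ s, (x : Fin n → ZMod 2) i
      map_zero' := by simp
      map_add' := fun x y => by simp [Finset.sum_add_distrib] }
  simpa [φ, sgn_sum] using sum_sgn_nonneg φ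

/-- Newton's identities for the signs of the coordinates of `x`. -/
lemma newton_signEsymm (k : ℕ) (x : Fin n → ZMod 2) :
    k * signEsymm k x = (-1) ^ (k + 1) *
      ∑ a ∈ Finset.HasAntidiagonal.antidiagonal k with a.1 < k,
        (-1) ^ a.1 * signEsymm a.1 x * ∑ i, sgn (x i) ^ a.2 := by
  have h := congrArg (MvPolynomial.aeval fun i => sgn (x i))
    (MvPolynomial.mul_esymm_eq_sum (Fin n) ℤ k)
  simpa [MvPolynomial.esymm, MvPolynomial.psum, signEsymm] using h

/-- The values of the first Krawtchouk polynomials, in terms of `y = n - 2 wt x`. -/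
lemma signEsymm_recursion (x : Fin n → ZMod 2) {y : ℤ} (hy : y = n - 2 * wt x) :
    signEsymm 1 x = y ∧ 2 * signEsymm 2 x = signEsymm 1 x * y - n ∧
    3 * signEsymm 3 x = signEsymm 2 x * y - signEsymm 1 x * n + y ∧
    4 * signEsymm 4 x = signEsymm 3 x * y - signEsymm 2 x * n + signEsymm 1 x * y - n ∧
    5 * signEsymm 5 x =
      signEsymm 4 x * y - signEsymm 3 x * n + signEsymm 2 x * y - signEsymm 1 x * n + y := by
  have h0 : signEsymm 0 x = 1 := by simp [signEsymm]
  have p1 : ∑ i, sgn (x i) = y := by rw [sum_sgn_apply, hy]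
  have q2 (a : ZMod 2) : sgn a ^ 2 = 1 := by revert a; decide
  have q3 (a : ZMod 2) : sgn a ^ 3 = sgn a := by revert a; decide
  have q4 (a : ZMod 2) : sgn a ^ 4 = 1 := by revert a; decide
  have q5 (a : ZMod 2) : sgn a ^ 5 = sgn a := by revert a; decide
  have h1 := newton_signEsymm 1 x
  have h2 := newton_signEsymm 2 x
  have h3 := newton_signEsymm 3 x
  have h4 := newton_signEsymm 4 x
  have h5 := newton_signEsymm 5 x
  simp [Finset.sum_filter, Finset.Nat.sum_antidiagonal_eq_sum_range_succ_mk, Finset.sum_range_succ,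
    q2, q3, q4, q5, p1, h0] at h1 h2 h3 h4 h5
  refine ⟨?_, ?_, ?_, ?_, ?_⟩ <;> linarith

/-- The linear programming inequality, at a single codeword. -/
lemma signEsymm_le_halfSign {x : Fin 25 → ZMod 2} (heven : Even (wt x)) (h8 : 8 ≤ wt x) :
    22 + 22 * signEsymm 1 x + 6 * signEsymm 2 x + 6 * signEsymm 3 x + signEsymm 4 x +
      signEsymm 5 x ≤ 32 * halfSign x := by
  have hle : wt x ≤ 25 := (Finset.card_le_univ _).trans_eq (Fintype.card_fin 25)
  obtain ⟨h1, h2, h3, h4, h5⟩ := signEsymm_recursion x rfl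
  unfold halfSign
  generalize wt x = w at *
  interval_cases w <;> first | (exact absurd heven (by decide)) | skip
  all_goals
    norm_num at h1 h2 h3 h4 h5 ⊢
    rw [h1] at h2 h3 h4 h5
    omega

lemma le_sum_halfSign (D : Submodule (ZMod 2) (Fin 25 → ZMod 2)) [Fintype D]
    (hcard : Fintype.card D = 4096) (heven : ∀ x ∈ D, Even (wt x))
    (h8 : ∀ x ∈ D, x ≠ 0 → 8 ≤ wt x) :
    256 ≤ ∑ x : D, halfSign (x : Fin 25 → ZMod 2) := by
  classical
  let F (x : Fin 25 → ZMod 2) : ℤ := 22 * signEsymm 1 x + 6 * signEsymm 2 x +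
    6 * signEsymm 3 x + signEsymm 4 x + signEsymm 5 x
  have hF0 : F 0 = 81930 := by
    obtain ⟨h1, h2, h3, h4, h5⟩ := signEsymm_recursion (0 : Fin 25 → ZMod 2) rfl
    simp only [F]
    norm_num [wt] at h1 h2 h3 h4 h5
    rw [h1] at h2 h3 h4 h5
    omega
  have hpt (x : D) : 22 + F x - (if x = 0 then 81920 else 0) ≤
      32 * halfSign (x : Fin 25 → ZMod 2) := by
    split_ifs with hx
    · rw [hx, ZeroMemClass.coe_zero, hF0]
      norm_num [halfSign, wt]
    · have := signEsymm_le_halfSign (heven x x.2) (h8 x x.2 (by simpa using hx))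
      simp only [F]
      linarith
  have hsum := Finset.sum_le_sum fun (x : D) (_ : x ∈ Finset.univ) => hpt x
  rw [Finset.sum_sub_distrib, Finset.sum_add_distrib, ← Finset.mul_sum, Finset.sum_ite_eq',
    Finset.sum_const, Finset.card_univ, hcard] at hsum
  have hF : 0 ≤ ∑ x : D, F x := by
    simp only [F, Finset.sum_add_distrib, ← Finset.mul_sum]
    have := sum_signEsymm_nonneg D
    linarith [this 1, this 2, this 3, this 4, this 5]
  norm_num at hsum
  linarith

end LinearProgramming

section Extension

variable {n : ℕ}

/-- Extension of a vector by an overall parity check coordinate. -/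
def parityExtend : (Fin n → ZMod 2) →ₗ[ZMod 2] (Fin (n + 1) → ZMod 2) where
  toFun x := Fin.snoc x (∑ i, x i)
  map_add' x y := by
    ext i
    refine Fin.lastCases ?_ (fun i => ?_) i <;> simp [Finset.sum_add_distrib]
  map_smul' c x := by
    ext i
    refine Fin.lastCases ?_ (fun i => ?_) i <;> simp [Finset.mul_sum]

lemma parityExtend_castSucc (x : Fin n → ZMod 2) (i : Fin n) :
    parityExtend x i.castSucc = x i := by
  simp [parityExtend]

lemma parityExtend_last (x : Fin n → ZMod 2) : parityExtend x (Fin.last n) = ∑ i, x i := by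
  simp [parityExtend]

lemma parityExtend_injective : Function.Injective (parityExtend (n := n)) := fun x y h => by
  ext i
  rw [← parityExtend_castSucc x, h, parityExtend_castSucc]

lemma wt_parityExtend (x : Fin n → ZMod 2) :
    wt (parityExtend x) = wt x + (∑ i, x i).val := by
  simp [wt_eq_sum, Fin.sum_univ_castSucc, parityExtend_castSucc, parityExtend_last]

lemma even_wt_parityExtend (x : Fin n → ZMod 2) : Even (wt (parityExtend x)) := by
  rw [← ZMod.natCast_eq_zero_iff_even, wt_parityExtend, Nat.cast_add, natCast_wt,
    ZMod.natCast_zmod_val]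
  exact CharTwo.add_self_eq_zero _

/-- Extending an LCD code by a parity check makes its hull at most one-dimensional. -/
lemma card_hull_parityExtend_le {C : Submodule (ZMod 2) (Fin n → ZMod 2)} (hC : IsLCD C)
    [Fintype ↥(C.map parityExtend ⊓ dualCode (C.map parityExtend))] :
    Fintype.card ↥(C.map parityExtend ⊓ dualCode (C.map parityExtend)) ≤ 2 := by
  let R := C.map parityExtend ⊓ dualCode (C.map parityExtend)
  let ψ : R →ₗ[ZMod 2] ZMod 2 := LinearMap.proj (Fin.last n) ∘ₗ R.subtype
  have hψ : Function.Injective ψ := by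
    rw [injective_iff_map_eq_zero]
    rintro ⟨_, ⟨x, hx, rfl⟩, hxd⟩ h0
    have h0 : ∑ i, x i = 0 := by rw [← parityExtend_last]; exact h0
    have hxC : x ∈ C ⊓ dualCode C := by
      refine ⟨hx, fun y hy => ?_⟩
      have := hxd _ (Submodule.mem_map_of_mem hy)
      simpa [Fin.sum_univ_castSucc, parityExtend_castSucc, parityExtend_last, h0] using this
    rw [IsLCD] at hC
    rw [hC, Submodule.mem_bot] at hxC
    ext1
    simp [hxC]
  exact (Fintype.card_le_of_injective ψ hψ).trans_eq (ZMod.card 2)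

lemma minWt_le_six {C : Submodule (ZMod 2) (Fin 24 → ZMod 2)}
    (hdim : Module.finrank (ZMod 2) C = 12) (hC : IsLCD C) : minWt C ≤ 6 := by
  classical
  by_contra! hcon
  let D := C.map parityExtend
  have heven : ∀ x ∈ D, Even (wt x) := by
    rintro _ ⟨x, -, rfl⟩
    exact even_wt_parityExtend x
  have h8 : ∀ x ∈ D, x ≠ 0 → 8 ≤ wt x := by
    rintro _ ⟨x, hx, rfl⟩ h0
    have hle : minWt C ≤ wt x := Nat.sInf_le ⟨x, hx, fun h => h0 (by rw [h, map_zero]), rfl⟩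
    obtain ⟨m, hm⟩ := even_wt_parityExtend x
    have := wt_parityExtend x
    omega
  have hcard : Fintype.card D = 4096 := by
    rw [Module.card_eq_pow_finrank (K := ZMod 2), ZMod.card,
      ← (Submodule.equivMapOfInjective parityExtend parityExtend_injective C).finrank_eq, hdim]
    norm_num
  have hlow := le_sum_halfSign D hcard heven h8
  have hup := sq_sum_halfSign_le heven
  have hhull : (Fintype.card ↥(D ⊓ dualCode D) : ℤ) ≤ 2 := by
    exact_mod_cast card_hull_parityExtend_le hC
  rw [hcard] at hup
  push_cast at hup
  nlinarith

end Extension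

section Existence

/-- The length-24 vector whose coordinates are the binary digits of `a`. -/
def bits (a : ℕ) (i : Fin 24) : ZMod 2 := if a.testBit i then 1 else 0

lemma bits_zero : bits 0 = 0 := by
  ext i; simp [bits]

lemma bits_xor (a b : ℕ) : bits (a ^^^ b) = bits a + bits b := by
  ext i
  simp only [bits, Nat.testBit_xor, Pi.add_apply]
  cases a.testBit i <;> cases b.testBit i <;> decide

lemma wt_bits (a : ℕ) :
    wt (bits a) = Finset.card (Finset.univ.filter fun i : Fin 24 => a.testBit i) := by
  simp [wt, bits]

/-- Checks that every nonzero vector of `bits a + span (bits rs)` has weight at least `d`. -/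
def checkWt (d : ℕ) : List ℕ → ℕ → Bool
  | [], a => a == 0 || d ≤ Finset.card (Finset.univ.filter fun i : Fin 24 => a.testBit i)
  | r :: rs, a => checkWt d rs a && checkWt d rs (a ^^^ r)

lemma le_wt_of_checkWt {d : ℕ} {rs : List ℕ} {a : ℕ} (h : checkWt d rs a = true)
    {y : Fin 24 → ZMod 2} (hy : y ∈ Submodule.span (ZMod 2) (Set.image bits {r | r ∈ rs}))
    (h0 : bits a + y ≠ 0) : d ≤ wt (bits a + y) := by
  induction rs generalizing a y with
  | nil =>
    obtain rfl : y = 0 := by simpa using hy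
    rw [add_zero] at h0 ⊢
    rw [checkWt, Bool.or_eq_true, beq_iff_eq, decide_eq_true_iff] at h
    rcases h with rfl | h
    · exact absurd bits_zero h0
    · rwa [wt_bits]
  | cons r rs ih =>
    rw [checkWt, Bool.and_eq_true] at h
    have hset : Set.image bits {s | s ∈ r :: rs} = insert (bits r) (Set.image bits {s | s ∈ rs}) := by
      rw [← Set.image_insert_eq]; congr 1; ext; simp
    rw [hset, Submodule.mem_span_insert] at hy
    obtain ⟨c, z, hz, rfl⟩ := hy
    obtain rfl | rfl := (by decide : ∀ c : ZMod 2, c = 0 ∨ c = 1) c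
    · rw [zero_smul, zero_add] at h0 ⊢
      exact ih h.1 hz h0
    · rw [one_smul, ← add_assoc, ← bits_xor] at h0 ⊢
      exact ih h.2 hz h0

/-- Generators, encoded through `bits`, of an LCD `[24,12,6]` code. -/
def genRow : Fin 12 → ℕ :=
  ![6496257, 12763138, 10588164, 741384, 1224720, 385056,
    14159936, 11804800, 7094528, 2863616, 5497856, 8902656]

/-- The Gram matrix of the generators is the permutation matrix of this involution. -/
def dualIndex : Fin 12 → Fin 12 := ![6, 7, 8, 10, 11, 9, 0, 1, 2, 5, 3, 4]

lemma bits_genRow_dual (i j : Fin 12) :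
    ∑ k, bits (genRow i) k * bits (genRow (dualIndex j)) k = if i = j then 1 else 0 := by
  revert i j
  decide +kernel

lemma sum_smul_genRow_dual (g : Fin 12 → ZMod 2) (j : Fin 12) :
    ∑ k, (∑ i, g i • bits (genRow i)) k * bits (genRow (dualIndex j)) k = g j := by
  simp only [Finset.sum_apply, Pi.smul_apply, smul_eq_mul, Finset.sum_mul, mul_assoc]
  rw [Finset.sum_comm]
  simp [← Finset.mul_sum, bits_genRow_dual]

lemma checkWt_genRow : checkWt 6 (List.ofFn genRow) 0 = true := by
  decide +kernel

lemma exists_lcd_24_12_6 : ∃ C : Submodule (ZMod 2) (Fin 24 → ZMod 2),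
    Module.finrank (ZMod 2) C = 12 ∧ IsLCD C ∧ minWt C = 6 := by
  have hmem (i : Fin 12) :
      bits (genRow i) ∈ Submodule.span (ZMod 2) (Set.range fun i => bits (genRow i)) :=
    Submodule.subset_span ⟨i, rfl⟩
  refine ⟨Submodule.span (ZMod 2) (Set.range fun i => bits (genRow i)), ?_, ?_, ?_⟩
  · rw [finrank_span_eq_card, Fintype.card_fin]
    refine Fintype.linearIndependent_iff.2 fun g hg j => ?_
    rw [← sum_smul_genRow_dual g j, hg]
    simp
  · rw [IsLCD, eq_bot_iff]
    rintro x ⟨hx, hxd⟩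
    obtain ⟨g, rfl⟩ := (Submodule.mem_span_range_iff_exists_fun (ZMod 2)).1 hx
    have hg (j : Fin 12) : g j = 0 := by
      rw [← sum_smul_genRow_dual g j]
      exact hxd _ (hmem _)
    simp [hg]
  · have hwt : wt (bits (genRow 0)) = 6 := by rw [wt_bits]; decide +kernel
    have hne : bits (genRow 0) ≠ 0 := fun h => by
      rw [h] at hwt
      simp [wt] at hwt
    refine le_antisymm (Nat.sInf_le ⟨_, hmem 0, hne, hwt⟩)
      (le_csInf ⟨6, _, hmem 0, hne, hwt⟩ ?_)
    rintro _ ⟨x, hx, hx0, rfl⟩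
    have hset : (Set.range fun i => bits (genRow i)) = Set.image bits {r | r ∈ List.ofFn genRow} := by
      ext
      simp only [Set.mem_range, Set.mem_image, Set.mem_ofPred_eq, List.mem_ofFn,
        exists_exists_eq_and]
    rw [hset] at hx
    have := le_wt_of_checkWt checkWt_genRow hx
    rw [bits_zero, zero_add] at this
    exact this hx0

end Existence

theorem lcd_24_12 :
    (∃ C : Submodule (ZMod 2) (Fin 24 → ZMod 2),
      Module.finrank (ZMod 2) C = 12 ∧ IsLCD C ∧ minWt C = 6) ∧
    (∀ C : Submodule (ZMod 2) (Fin 24 → ZMod 2),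
      Module.finrank (ZMod 2) C = 12 → IsLCD C → minWt C ≤ 6) := by
  exact ⟨exists_lcd_24_12_6, fun _ => minWt_le_six⟩
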